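/- The complex-valued improper integral ∫_0^∞ x log(-x) log(log(-x)) / (1+x^4) dx, where for real x > 0 the quantity log(-x) denotes the principal complex logarithm of the negative real number -x (so log(-x) = log x + iπ) and the outer logarithm is also the principal complex logarithm, equals -(π/8) ( 2 i C + π ( π - i·log(27 π² / 16) ) ), where C = ∑_{n=0}^∞ (-1)^n / (2n+1)² is Catalan's constant. -/

import Mathlib

open Complex MeasureTheory

/-- Catalan's constant `C = ∑_{n=0}^∞ (-1)^n / (2n+1)^2`. -/
noncomputable def catalan' : ℝ := ∑' n : ℕ, (-1 : ℝ) ^ n / (2 * n + 1) ^ 2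

open Filter Topology

noncomputable def gg (z : ℂ) : ℂ := z * Complex.log (-(I * z))
noncomputable def dd (z : ℂ) : ℂ := 2 * Complex.cosh (2 * z)

lemma gg_norm_le (z : ℂ) : ‖gg z‖ ≤ |Real.log ‖z‖ * ‖z‖| + Real.pi * ‖z‖ := by
  unfold gg
  rw [norm_mul, abs_mul, abs_of_nonneg (norm_nonneg z)]
  have h : ‖Complex.log (-(I * z))‖ ≤ |Real.log ‖z‖| + Real.pi := by
    refine (Complex.norm_le_abs_re_add_abs_im _).trans ?_
    have h1 : ‖-(I * z)‖ = ‖z‖ := by simp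
    rw [Complex.log_re, Complex.log_im, h1]
    gcongr
    exact Complex.abs_arg_le_pi _
  nlinarith [norm_nonneg z]

lemma gg_norm_le2 (z : ℂ) : ‖gg z‖ ≤ 2 * (1 + ‖z‖) ^ 2 := by
  have h := gg_norm_le z
  have hp : Real.pi < 4 := by linarith [Real.pi_lt_d2]
  have h0 := norm_nonneg z
  have : |Real.log ‖z‖ * ‖z‖| ≤ 1 + ‖z‖ ^ 2 := by
    rcases h0.eq_or_lt with h1 | h1
    · rw [← h1]; simp
    rcases le_or_gt ‖z‖ 1 with h2 | h2
    · have := Real.abs_log_mul_self_lt _ h1 h2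
      nlinarith
    · have h3 := Real.log_le_sub_one_of_pos h1
      have h4 := Real.log_pos h2
      rw [abs_of_nonneg (by positivity)]
      nlinarith
  nlinarith

lemma exp_poly (s : ℝ) (hs : 0 ≤ s) : (1 + s) ^ 2 ≤ 4 * Real.exp s := by
  have h := Real.add_one_le_exp (s / 2)
  have h2 : Real.exp s = Real.exp (s/2) ^ 2 := by rw [← Real.exp_nat_mul]; congr 1; push_cast; ring
  rw [h2]
  nlinarith

lemma gg_bound (t a : ℝ) (ha : 0 ≤ a) :
    ‖gg (t + a * I)‖ ≤ 8 * (1 + a) ^ 2 * Real.exp |t| := by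
  have h1 : ‖(t + a * I : ℂ)‖ ≤ |t| + a := by
    refine (norm_add_le _ _).trans ?_
    simp [abs_of_nonneg ha]
  have h2 := gg_norm_le2 (t + a * I)
  have h3 := exp_poly |t| (abs_nonneg t)
  have h0 := norm_nonneg (t + a * I : ℂ)
  have ht := abs_nonneg t
  have h4 : (1 + ‖(t + a * I : ℂ)‖) ^ 2 ≤ ((1 + a) * (1 + |t|)) ^ 2 := by
    gcongr; nlinarith
  calc _ ≤ _ := h2
    _ ≤ 2 * ((1 + a) * (1 + |t|)) ^ 2 := by linarith
    _ = 2 * (1 + a) ^ 2 * (1 + |t|) ^ 2 := by ring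
    _ ≤ 2 * (1 + a) ^ 2 * (4 * Real.exp |t|) := by gcongr
    _ = _ := by ring

lemma gg_continuousAt (z : ℂ) (hz : 0 ≤ z.im) : ContinuousAt gg z := by
  by_cases h : z = 0
  · subst h
    have h0 : gg 0 = 0 := by simp [gg]
    unfold ContinuousAt
    rw [h0, tendsto_zero_iff_norm_tendsto_zero]
    have hc : Continuous fun z : ℂ => |Real.log ‖z‖ * ‖z‖| + Real.pi * ‖z‖ := by
      have := Real.continuous_mul_log.comp (continuous_norm (E := ℂ))
      have h2 : (fun z : ℂ => |Real.log ‖z‖ * ‖z‖| + Real.pi * ‖z‖) =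
        fun z : ℂ => |((fun x => x * Real.log x) ∘ norm) z| + Real.pi * ‖z‖ := by
        ext z; simp [mul_comm]
      rw [h2]
      exact (this.abs).add (continuous_const.mul continuous_norm)
    have h1 := hc.tendsto 0
    simp only [norm_zero, mul_zero, abs_zero, add_zero] at h1
    exact squeeze_zero (fun _ => norm_nonneg _) gg_norm_le h1
  · unfold gg
    refine continuousAt_id.mul (ContinuousAt.clog (by fun_prop) ?_)
    rw [Complex.mem_slitPlane_iff]
    rcases hz.eq_or_lt with h1 | h1
    · right
      simp only [neg_im, mul_im, I_re, I_im]
      intro h2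
      apply h
      apply Complex.ext
      · simp at h2 ⊢; exact h2
      · simp [← h1]
    · left; simpa using h1

lemma gg_differentiableAt (z : ℂ) (hz : 0 < z.im) : DifferentiableAt ℂ gg z := by
  unfold gg
  refine differentiableAt_id.mul (DifferentiableAt.clog (by fun_prop) ?_)
  rw [Complex.mem_slitPlane_iff]
  left; simpa using hz

lemma dd_real (t : ℝ) : dd t = ((2 * Real.cosh (2 * t) : ℝ) : ℂ) := by
  unfold dd; push_cast; rfl

lemma dd_shift (z : ℂ) : dd (z + (Real.pi / 2 : ℝ) * I) = - dd z := by
  unfold dd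
  have : 2 * (z + (Real.pi / 2 : ℝ) * I) = 2 * z + Real.pi * I := by push_cast; ring
  rw [this, Complex.cosh_add, Complex.cosh_mul_I, Complex.sinh_mul_I]
  simp

lemma cosh_lower (t : ℝ) : Real.exp (2 * |t|) ≤ 2 * Real.cosh (2 * t) := by
  have : Real.cosh (2 * t) = Real.cosh (2 * |t|) := by
    rw [← Real.cosh_abs (2 * t), abs_mul]; simp
  rw [this, Real.cosh_eq]
  linarith [Real.exp_pos (-(2 * |t|))]

lemma dd_ne (t : ℝ) : dd t ≠ 0 := by
  rw [dd_real]; norm_cast; have := Real.cosh_pos (2 * t); positivity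

lemma dd_norm_real (t : ℝ) : Real.exp (2 * |t|) ≤ ‖dd t‖ := by
  rw [dd_real, Complex.norm_real]
  exact (cosh_lower t).trans (le_abs_self _)

lemma int_exp_abs : Integrable (fun t : ℝ => Real.exp (- |t|)) := by
  rw [← integrableOn_univ, ← Set.Iic_union_Ioi (a := (0:ℝ))]
  refine IntegrableOn.union ?_ ?_
  · refine (integrableOn_exp_Iic 0).congr_fun ?_ measurableSet_Iic
    intro x hx
    simp [abs_of_nonpos (Set.mem_Iic.1 hx)]
  · refine (integrableOn_exp_neg_Ioi 0).congr_fun ?_ measurableSet_Ioi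
    intro x hx
    simp [abs_of_pos (Set.mem_Ioi.1 hx)]

lemma int_of_bound (f : ℝ → ℂ) (hf : Continuous f) (K : ℝ)
    (h : ∀ t, ‖f t‖ ≤ K * Real.exp |t|) : Integrable (fun t : ℝ => f t / dd t) := by
  refine (int_exp_abs.const_mul K).mono' ?_ ?_
  · refine Continuous.aestronglyMeasurable (hf.div ?_ dd_ne)
    unfold dd; fun_prop
  · refine Eventually.of_forall fun t => ?_
    rw [norm_div]
    have h1 := dd_norm_real t
    have h2 : Real.exp (2 * |t|) = Real.exp |t| * Real.exp |t| := by
      rw [← Real.exp_add]; ring_nf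
    have h3 := Real.exp_pos |t|
    rw [div_le_iff₀ (lt_of_lt_of_le (Real.exp_pos _) h1)]
    have hK : 0 ≤ K := by
      have := (norm_nonneg _).trans (h t)
      exact nonneg_of_mul_nonneg_left this h3
    calc _ ≤ K * Real.exp |t| := h t
      _ = K * Real.exp (-|t|) * Real.exp (2 * |t|) := by
        rw [mul_assoc, ← Real.exp_add]; ring_nf
      _ ≤ _ := by gcongr

lemma gg_line_cont (a : ℝ) (ha : 0 ≤ a) : Continuous (fun t : ℝ => gg (t + a * I)) := by
  rw [continuous_iff_continuousAt]
  intro t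
  refine ContinuousAt.comp (f := fun t : ℝ => (t + a * I : ℂ)) (gg_continuousAt _ (by simpa using ha)) (by fun_prop)

lemma int_J (a : ℝ) (ha : 0 ≤ a) : Integrable (fun t : ℝ => gg (t + a * I) / dd t) :=
  int_of_bound _ (gg_line_cont a ha) _ (fun t => gg_bound t a ha)

lemma int_const (c : ℂ) : Integrable (fun t : ℝ => c / dd t) :=
  int_of_bound _ continuous_const ‖c‖ (fun t => by
    have := Real.one_le_exp (abs_nonneg t)
    nlinarith [norm_nonneg c])

lemma int_w_real : ∫ t : ℝ, 1 / (2 * Real.cosh (2 * t)) = Real.pi / 4 := by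
  have hi : Integrable (fun t : ℝ => 1 / (2 * Real.cosh (2 * t))) := by
    have := (int_const 1).re
    refine this.congr (Eventually.of_forall fun t => ?_)
    simp only [dd_real]
    norm_cast
  have hd : ∀ t : ℝ, HasDerivAt (fun t => (1/2) * Real.arctan (Real.exp (2 * t)))
      (1 / (2 * Real.cosh (2 * t))) t := by
    intro t
    have h1 : HasDerivAt (fun t : ℝ => 2 * t) 2 t := by simpa using (hasDerivAt_id t).const_mul 2
    have := ((h1.exp).arctan).const_mul (1/2)
    have e : 1 / (2 * Real.cosh (2 * t)) =
        1 / 2 * (1 / (1 + Real.exp (2 * t) ^ 2) * (Real.exp (2 * t) * 2)) := by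
      rw [Real.cosh_eq, Real.exp_neg]
      have := Real.exp_pos (2 * t)
      field_simp
      ring
    rw [e]; exact this
  have hb : Tendsto (fun t : ℝ => (1/2) * Real.arctan (Real.exp (2 * t))) atBot (𝓝 0) := by
    have h1 : Tendsto (fun t : ℝ => Real.exp (2 * t)) atBot (𝓝 0) :=
      Real.tendsto_exp_atBot.comp (tendsto_id.const_mul_atBot (by norm_num))
    have := ((Real.continuous_arctan.tendsto 0).comp h1).const_mul (1/2)
    simpa using this
  have ht : Tendsto (fun t : ℝ => (1/2) * Real.arctan (Real.exp (2 * t))) atTop (𝓝 (Real.pi / 4)) := by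
    have h1 : Tendsto (fun t : ℝ => Real.exp (2 * t)) atTop atTop :=
      Real.tendsto_exp_atTop.comp (tendsto_id.const_mul_atTop (by norm_num))
    have := ((Real.tendsto_arctan_atTop.mono_right nhdsWithin_le_nhds).comp h1).const_mul (1/2)
    rw [show Real.pi / 4 = 1 / 2 * (Real.pi / 2) by ring]; exact this
  rw [integral_of_hasDerivAt_of_tendsto hd hi hb ht]; ring

lemma int_w (c : ℂ) : ∫ t : ℝ, c / dd t = c * (Real.pi / 4) := by
  have : ∀ t : ℝ, c / dd t = c * ((1 / (2 * Real.cosh (2 * t)) : ℝ) : ℂ) := by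
    intro t; rw [dd_real]; push_cast; ring
  simp_rw [this]
  rw [integral_const_mul, integral_complex_ofReal, int_w_real]; push_cast; ring

lemma dd_zero_iff (z : ℂ) (h : dd z = 0) (h0 : 0 ≤ z.im) (h1 : z.im ≤ Real.pi / 2) :
    z = (Real.pi / 4 : ℝ) * I := by
  have hp := Real.pi_pos
  unfold dd at h
  have h : Complex.cosh (2 * z) = 0 := by simpa using h
  rw [← Complex.cos_mul_I, Complex.cos_eq_zero_iff] at h
  obtain ⟨k, hk⟩ := h
  have hre := congrArg Complex.re hk
  have him := congrArg Complex.im hk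
  have e : ((2 * (k:ℂ) + 1) * (Real.pi : ℂ) / 2) = (((2 * k + 1) * Real.pi / 2 : ℝ) : ℂ) := by push_cast; ring
  rw [e] at hre him
  rw [Complex.ofReal_re] at hre
  rw [Complex.ofReal_im] at him
  simp at hre him
  have hk1 : k = -1 := by
    have a1 : ((2 * k + 1 : ℤ) : ℝ) ≤ 0 := by
      push_cast; by_contra hc; push Not at hc; nlinarith [mul_pos hc hp]
    have a2 : ((2 * k + 1 : ℤ) : ℝ) ≥ -2 := by
      push_cast; by_contra hc; push Not at hc; nlinarith
    norm_cast at a1 a2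
    have a2 : (-2 : ℤ) ≤ 2 * k + 1 := by exact_mod_cast a2
    omega
  rw [hk1] at hre
  push_cast at hre
  apply Complex.ext
  · simpa using him
  · simp; linarith

lemma dd_norm_lower (x y : ℝ) (hx : 1 ≤ |x|) : Real.exp (2 * |x|) / 2 ≤ ‖dd (x + y * I)‖ := by
  have e : dd (x + y * I) = Complex.exp (2 * (x + y * I)) + Complex.exp (-(2 * (x + y * I))) := by
    unfold dd; rw [Complex.cosh]; ring
  have n1 : ‖Complex.exp (2 * (x + y * I))‖ = Real.exp (2 * x) := by
    rw [Complex.norm_exp]; simp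
  have n2 : ‖Complex.exp (-(2 * (x + y * I)))‖ = Real.exp (-(2 * x)) := by
    rw [Complex.norm_exp]; simp
  have key : ∀ s : ℝ, 1 ≤ s → Real.exp (2 * s) / 2 ≤ Real.exp (2 * s) - Real.exp (-(2 * s)) := by
    intro s hs
    have a1 := Real.add_one_le_exp (2 * s)
    have a2 : Real.exp (-(2 * s)) ≤ 1 := by rw [Real.exp_le_one_iff]; linarith
    linarith
  rw [e]
  rcases abs_cases x with ⟨h1, h2⟩ | ⟨h1, h2⟩
  · rw [h1] at hx ⊢
    have := norm_sub_norm_le (Complex.exp (2 * (x + y * I))) (-Complex.exp (-(2 * (x + y * I))))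
    rw [norm_neg, sub_neg_eq_add, n1, n2] at this
    exact (key x hx).trans this
  · rw [h1] at hx ⊢
    have := norm_sub_norm_le (Complex.exp (-(2 * (x + y * I)))) (-Complex.exp (2 * (x + y * I)))
    rw [norm_neg, sub_neg_eq_add, n1, n2, add_comm] at this
    have k := key (-x) hx
    rw [show -(2 * -x) = 2 * x by ring] at k
    rw [show -(2 * x) = 2 * -x by ring] at this
    exact k.trans this

lemma shift (a : ℝ) (ha : 0 ≤ a) :
    (∫ t : ℝ, gg (t + a * I) / dd t) + (∫ t : ℝ, gg (t + (a + Real.pi / 2 : ℝ) * I) / dd t) =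
      Real.pi / 2 * gg ((a + Real.pi / 4 : ℝ) * I) := by
  have hp := Real.pi_pos
  set z0 : ℂ := (Real.pi / 4 : ℝ) * I with hz0
  set h : ℂ → ℂ := fun z => gg (z + a * I) with hh
  set c : ℂ := gg ((a + Real.pi / 4 : ℝ) * I) with hc
  have hhz0 : h z0 = c := by
    simp only [hh, hz0, hc]; congr 1; push_cast; ring
  have z0im : z0.im = Real.pi / 4 := by simp [hz0]
  have z0re : z0.re = 0 := by simp [hz0]
  have hdz0 : dd z0 = 0 := by
    have : 2 * z0 = (Real.pi / 2 : ℂ) * I := by rw [hz0]; push_cast; ring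
    unfold dd
    rw [this, Complex.cosh_mul_I, Complex.cos_pi_div_two]; simp
  have hdder : HasDerivAt dd (4 * I) z0 := by
    have h1 : HasDerivAt (fun z : ℂ => 2 * z) 2 z0 := by simpa using (hasDerivAt_id z0).const_mul 2
    have := (h1.ccosh).const_mul 2
    have e : 2 * z0 = (Real.pi / 2 : ℂ) * I := by rw [hz0]; push_cast; ring
    rw [e, Complex.sinh_mul_I, Complex.sin_pi_div_two] at this
    have e2 : (4 * I : ℂ) = 2 * (1 * I * 2) := by ring
    rw [e2]; exact this
  have hddiff : Differentiable ℂ dd := by unfold dd; fun_prop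
  set F : ℂ → ℂ := fun z => dslope h z0 z / dslope dd z0 z with hF
  have hFne : ∀ z, z ≠ z0 → F z = (h z - c) / dd z := by
    intro z hz
    have hz' : z - z0 ≠ 0 := sub_ne_zero.2 hz
    simp only [hF, dslope_of_ne _ hz, slope_def_field, hhz0, hdz0, sub_zero]
    exact div_div_div_cancel_right₀ hz' _ _
  have hDne : ∀ z : ℂ, 0 ≤ z.im → z.im ≤ Real.pi / 2 → dslope dd z0 z ≠ 0 := by
    intro z h0 h1
    by_cases hz : z = z0
    · rw [hz, dslope_same, hdder.deriv]; simp
    · rw [dslope_of_ne _ hz, slope_def_field, hdz0, sub_zero]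
      refine div_ne_zero (fun h2 => hz (dd_zero_iff z h2 h0 h1)) (sub_ne_zero.2 hz)
  have hhc : ∀ z : ℂ, 0 ≤ z.im → ContinuousAt h z := by
    intro z hz
    refine ContinuousAt.comp (f := fun z : ℂ => z + a * I) (gg_continuousAt _ ?_) (by fun_prop)
    simp; positivity
  have hhd : ∀ z : ℂ, 0 < z.im → DifferentiableAt ℂ h z := by
    intro z hz
    refine DifferentiableAt.comp (f := fun z : ℂ => z + a * I) z (gg_differentiableAt _ ?_) (by fun_prop)
    simp; positivity
  have hFc : ∀ z : ℂ, 0 ≤ z.im → z.im ≤ Real.pi / 2 → ContinuousAt F z := by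
    intro z h0 h1
    refine ContinuousAt.div ?_ ?_ (hDne z h0 h1)
    · by_cases hz : z = z0
      · rw [hz, continuousAt_dslope_same]
        exact hhd _ (by rw [z0im]; positivity)
      · rw [continuousAt_dslope_of_ne hz]; exact hhc z h0
    · by_cases hz : z = z0
      · rw [hz, continuousAt_dslope_same]
        exact hddiff _
      · rw [continuousAt_dslope_of_ne hz]; exact (hddiff z).continuousAt
  have hFd : ∀ z : ℂ, 0 < z.im → z.im < Real.pi / 2 → z ≠ z0 → DifferentiableAt ℂ F z := by
    intro z h0 h1 hz
    refine DifferentiableAt.div ?_ ?_ (hDne z h0.le h1.le)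
    · rw [differentiableAt_dslope_of_ne hz]; exact hhd z h0
    · rw [differentiableAt_dslope_of_ne hz]; exact hddiff z
  have rect : ∀ R : ℝ, 0 ≤ R → (∫ x : ℝ in (-R)..R, F x) -
      (∫ x : ℝ in (-R)..R, F (x + (Real.pi / 2 : ℝ) * I)) =
      -(I * (∫ y : ℝ in (0:ℝ)..(Real.pi / 2), F (R + y * I)) -
      I * (∫ y : ℝ in (0:ℝ)..(Real.pi / 2), F ((-R : ℝ) + y * I))) := by
    intro R hR
    have := integral_boundary_rect_eq_zero_of_differentiable_on_off_countable F
      ((-R : ℝ) : ℂ) (R + (Real.pi / 2 : ℝ) * I) {z0} (Set.countable_singleton _) ?_ ?_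
    · simp only [add_re, ofReal_re, mul_re, I_re, mul_zero, ofReal_im, I_im, mul_one, sub_zero,
        add_zero, add_im, mul_im, zero_add, smul_eq_mul, ofReal_zero, zero_mul] at this
      linear_combination this
    · intro z hz
      rw [Complex.mem_reProdIm] at hz
      have h2 := hz.2
      simp only [add_im, mul_im, ofReal_im, ofReal_re, I_im, I_re, mul_one, mul_zero, add_zero, zero_add] at h2
      rw [Set.uIcc_of_le (by positivity)] at h2
      exact (hFc z h2.1 h2.2).continuousWithinAt
    · rintro z ⟨hz, hzz⟩
      rw [Complex.mem_reProdIm] at hz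
      have h2 := hz.2
      simp only [add_im, mul_im, ofReal_im, ofReal_re, I_im, I_re, mul_one, mul_zero, add_zero, zero_add] at h2
      rw [min_eq_left (by positivity), max_eq_right (by positivity)] at h2
      exact hFd z h2.1 h2.2 hzz
  -- integrands on the horizontal sides
  have hbot : ∀ t : ℝ, F t = gg (t + a * I) / dd t - c / dd t := by
    intro t
    rw [hFne, sub_div]
    intro he
    have := congrArg Complex.im he
    rw [z0im, Complex.ofReal_im] at this
    linarith
  have htop : ∀ t : ℝ, F (t + (Real.pi / 2 : ℝ) * I) =
      c / dd t - gg (t + (a + Real.pi / 2 : ℝ) * I) / dd t := by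
    intro t
    rw [hFne, dd_shift, ← sub_div, div_neg, ← neg_div]
    · congr 1
      simp only [hh]
      rw [neg_sub]; congr 2; push_cast; ring
    intro he
    have := congrArg Complex.im he
    rw [z0im] at this
    simp at this
    linarith
  have ha2 : 0 ≤ a + Real.pi / 2 := by positivity
  have i1 := (int_J a ha).sub (int_const c)
  have i2 := (int_const c).sub (int_J _ ha2)
  have t1 : Tendsto (fun R : ℝ => ∫ x : ℝ in (-R)..R, F x) atTop
      (𝓝 ((∫ t : ℝ, gg (t + a * I) / dd t) - c * (Real.pi / 4))) := by
    have := intervalIntegral_tendsto_integral i1 tendsto_neg_atTop_atBot tendsto_id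
    simp only [Pi.sub_apply, id] at this
    rw [integral_sub (int_J a ha) (int_const c), int_w] at this
    simp_rw [hbot]; exact this
  have t2 : Tendsto (fun R : ℝ => ∫ x : ℝ in (-R)..R, F (x + (Real.pi / 2 : ℝ) * I)) atTop
      (𝓝 (c * (Real.pi / 4) - (∫ t : ℝ, gg (t + (a + Real.pi / 2 : ℝ) * I) / dd t))) := by
    have := intervalIntegral_tendsto_integral i2 tendsto_neg_atTop_atBot tendsto_id
    simp only [Pi.sub_apply, id] at this
    rw [integral_sub (int_const c) (int_J _ ha2), int_w] at this
    simp_rw [htop]; exact this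
  -- vertical sides
  set K : ℝ := 8 * (1 + (a + Real.pi / 2)) ^ 2 + ‖c‖ with hK
  have vert : ∀ x : ℝ, 1 ≤ |x| →
      ‖∫ y : ℝ in (0:ℝ)..(Real.pi / 2), F (x + y * I)‖ ≤ 2 * K * Real.exp (-|x|) * (Real.pi / 2) := by
    intro x hx
    have := intervalIntegral.norm_integral_le_of_norm_le_const (a := 0) (b := Real.pi / 2)
      (f := fun y : ℝ => F (x + y * I)) (C := 2 * K * Real.exp (-|x|)) ?_
    · rwa [sub_zero, abs_of_nonneg (by positivity : (0:ℝ) ≤ Real.pi / 2)] at this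
    intro y hy
    rw [Set.uIoc_of_le (by positivity)] at hy
    have hne : (x + y * I : ℂ) ≠ z0 := by
      intro he
      have := congrArg Complex.re he
      rw [z0re] at this
      simp at this
      rw [this] at hx; norm_num at hx
    rw [hFne _ hne, norm_div]
    have d := dd_norm_lower x y hx
    have dpos : 0 < ‖dd (x + y * I)‖ := lt_of_lt_of_le (by positivity) d
    rw [div_le_iff₀ dpos]
    have e1 : h (x + y * I) = gg (x + (y + a : ℝ) * I) := by
      simp only [hh]; congr 1; push_cast; ring
    have b := gg_bound x (y + a) (by linarith [hy.1])
    have b2 : 8 * (1 + (y + a)) ^ 2 * Real.exp |x| ≤ 8 * (1 + (a + Real.pi / 2)) ^ 2 * Real.exp |x| := by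
      have : 0 ≤ y := hy.1.le
      have : y ≤ Real.pi / 2 := hy.2
      gcongr 8 * ?_ ^ 2 * _
      linarith
    have b3 : ‖c‖ ≤ ‖c‖ * Real.exp |x| := by
      have := Real.one_le_exp (abs_nonneg x)
      nlinarith [norm_nonneg c]
    calc ‖h (x + y * I) - c‖ ≤ ‖h (x + y * I)‖ + ‖c‖ := norm_sub_le _ _
      _ ≤ K * Real.exp |x| := by rw [e1, hK]; linarith
      _ = 2 * K * Real.exp (-|x|) * (Real.exp (2 * |x|) / 2) := by
        have : Real.exp |x| = Real.exp (-|x|) * Real.exp (2 * |x|) := by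
          rw [← Real.exp_add]; ring_nf
        rw [this]; ring
      _ ≤ _ := by gcongr
  have ev : Tendsto (fun R : ℝ => 2 * K * Real.exp (-|R|) * (Real.pi / 2)) atTop (𝓝 0) := by
    have h1 : Tendsto (fun R : ℝ => Real.exp (-|R|)) atTop (𝓝 0) :=
      Real.tendsto_exp_neg_atTop_nhds_zero.comp tendsto_abs_atTop_atTop
    have := (h1.const_mul (2 * K)).mul_const (Real.pi / 2)
    simpa using this
  have v1 : Tendsto (fun R : ℝ => ∫ y : ℝ in (0:ℝ)..(Real.pi / 2), F (R + y * I)) atTop (𝓝 0) := by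
    refine squeeze_zero_norm' ?_ ev
    filter_upwards [eventually_ge_atTop 1] with R hR
    exact vert R (hR.trans (le_abs_self R))
  have v2 : Tendsto (fun R : ℝ => ∫ y : ℝ in (0:ℝ)..(Real.pi / 2), F ((-R : ℝ) + y * I)) atTop (𝓝 0) := by
    refine squeeze_zero_norm' ?_ ev
    filter_upwards [eventually_ge_atTop 1] with R hR
    have := vert (-R) (by rw [abs_neg]; exact hR.trans (le_abs_self R))
    rwa [abs_neg] at this
  have l1 := t1.sub t2
  have l2 := ((v1.const_mul I).sub (v2.const_mul I)).neg
  have l3 := l1.congr' (by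
    filter_upwards [eventually_ge_atTop 0] with R hR using rect R hR)
  have := tendsto_nhds_unique l3 l2
  simp only [mul_zero, sub_zero, neg_zero] at this
  linear_combination this

lemma cat_term (n : ℕ) :
    ∫ t in Set.Ioi (0:ℝ), t * Real.exp (-((4 * n + 2 : ℝ) * t)) = 1 / (4 * n + 2 : ℝ) ^ 2 := by
  have := Real.integral_rpow_mul_exp_neg_mul_Ioi (a := 2) (r := 4 * n + 2) (by norm_num) (by positivity)
  rw [Real.Gamma_two, mul_one] at this
  rw [show (2:ℝ) - 1 = 1 by norm_num] at this
  simp only [Real.rpow_one] at this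
  rw [this, Real.rpow_two]; simp

lemma cat_term_int (n : ℕ) :
    Integrable (fun t : ℝ => t * Real.exp (-((4 * n + 2 : ℝ) * t))) (volume.restrict (Set.Ioi 0)) := by
  apply Integrable.of_integral_ne_zero
  rw [cat_term]; positivity

lemma cat_int : ∫ t in Set.Ioi (0:ℝ), t / (2 * Real.cosh (2 * t)) = catalan' / 4 := by
  have hs := hasSum_integral_of_summable_integral_norm (μ := volume.restrict (Set.Ioi (0:ℝ)))
    (F := fun (n : ℕ) (t : ℝ) => (-1) ^ n * (t * Real.exp (-((4 * n + 2 : ℝ) * t))))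
    (fun n => (cat_term_int n).const_mul _) ?_
  · have e : ∫ t in Set.Ioi (0:ℝ), t / (2 * Real.cosh (2 * t)) = ∫ t in Set.Ioi (0:ℝ),
        ∑' n : ℕ, (-1) ^ n * (t * Real.exp (-((4 * n + 2 : ℝ) * t))) := by
      refine setIntegral_congr_fun measurableSet_Ioi fun t ht => ?_
      have ht : 0 < t := ht
      have hq : |-Real.exp (-(4 * t))| < 1 := by
        rw [abs_neg, abs_of_pos (Real.exp_pos _), Real.exp_lt_one_iff]; linarith
      have h2 : ∀ n : ℕ, (-1) ^ n * (t * Real.exp (-((4 * n + 2 : ℝ) * t))) =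
          t * Real.exp (-(2 * t)) * (-Real.exp (-(4 * t))) ^ n := by
        intro n
        have : Real.exp (-((4 * n + 2 : ℝ) * t)) = Real.exp (-(2 * t)) * Real.exp (-(4 * t)) ^ n := by
          rw [← Real.exp_nat_mul, ← Real.exp_add]; ring_nf
        rw [this, neg_pow (Real.exp _)]; ring
      simp_rw [h2]
      rw [tsum_mul_left, tsum_geometric_of_abs_lt_one hq, Real.cosh_eq]
      have h3 : Real.exp (-(4 * t)) = Real.exp (-(2 * t)) ^ 2 := by
        rw [← Real.exp_nat_mul]; ring_nf
      have h4 : Real.exp (2 * t) = (Real.exp (-(2 * t)))⁻¹ := by rw [← Real.exp_neg]; ring_nf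
      rw [h3, h4]
      have := Real.exp_pos (-(2 * t))
      generalize Real.exp (-(2 * t)) = E at *
      have h5 : 1 - -E ^ 2 = 1 + E ^ 2 := by ring
      rw [h5]
      have h6 : 1 + E ^ 2 ≠ 0 := by positivity
      field_simp
    rw [e, ← hs.tsum_eq, catalan', ← tsum_div_const]
    refine tsum_congr fun n => ?_
    rw [integral_const_mul, cat_term]
    field_simp
    ring
  · have e : ∀ n : ℕ, ∫ t in Set.Ioi (0:ℝ), ‖(-1) ^ n * (t * Real.exp (-((4 * n + 2 : ℝ) * t)))‖ =
        1 / (4 * n + 2 : ℝ) ^ 2 := by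
      intro n
      rw [← cat_term]
      refine setIntegral_congr_fun measurableSet_Ioi fun t ht => ?_
      have ht : 0 < t := ht
      simp [abs_of_pos ht]
    simp_rw [e]
    have h1 : Summable fun n : ℕ => 1 / ((n + 1 : ℕ) : ℝ) ^ 2 :=
      (summable_nat_add_iff 1).2 (Real.summable_one_div_nat_pow.2 (by norm_num))
    refine Summable.of_nonneg_of_le (fun n => by positivity) (fun n => ?_) h1
    apply one_div_le_one_div_of_le (by positivity)
    push_cast
    gcongr
    · linarith [(Nat.cast_nonneg n : (0:ℝ) ≤ n)]
    · norm_num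

lemma dd_neg (z : ℂ) : dd (-z) = dd z := by
  unfold dd; rw [mul_neg, Complex.cosh_neg]

lemma gg_symm (t : ℝ) : gg t + gg (-t) = -(I * Real.pi) * |t| := by
  have key : ∀ s : ℝ, 0 < s → gg s + gg (-s) = -(I * Real.pi) * s := by
    intro s hs
    have e1 : -(I * (s:ℂ)) = s * (-I) := by ring
    have e2 : -(I * (-s:ℂ)) = s * I := by ring
    unfold gg
    rw [e1, e2, Complex.log_ofReal_mul hs (by simp), Complex.log_ofReal_mul hs (by simp),
      Complex.log_neg_I, Complex.log_I]
    ring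
  rcases lt_trichotomy t 0 with h | h | h
  · have := key (-t) (by linarith)
    rw [abs_of_neg h]
    push_cast at this ⊢
    rw [neg_neg] at this
    rw [add_comm]; exact this
  · subst h; simp [gg]
  · rw [abs_of_pos h]; exact key t h

lemma J0 : ∫ t : ℝ, gg (t + (0:ℝ) * I) / dd t = -(I * Real.pi) * catalan' / 4 := by
  have h1 := int_J 0 le_rfl
  have e : ∫ t : ℝ, gg (t + (0:ℝ) * I) / dd t = ∫ t : ℝ, gg (-t) / dd t := by
    rw [← integral_neg_eq_self]
    congr 1; ext t
    push_cast
    rw [dd_neg]; simp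
  have h2 : Integrable fun t : ℝ => gg (-t) / dd t := by
    have := h1.comp_neg
    refine this.congr (Eventually.of_forall fun t => ?_)
    simp [dd_neg]
  have h3 := integral_add h1 h2
  rw [← e] at h3
  have h4 : ∀ t : ℝ, gg (t + (0:ℝ) * I) / dd t + gg (-t) / dd t =
      -(I * Real.pi) * (((fun s : ℝ => s / (2 * Real.cosh (2 * s))) |t| : ℝ) : ℂ) := by
    intro t
    have : Real.cosh (2 * |t|) = Real.cosh (2 * t) := by
      rw [← Real.cosh_abs (2 * t), abs_mul]; simp
    rw [← add_div, Complex.ofReal_zero, zero_mul, add_zero, gg_symm, dd_real]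
    simp only [this]
    push_cast; ring
  simp_rw [h4] at h3
  rw [integral_const_mul, integral_complex_ofReal,
    integral_comp_abs (f := fun s : ℝ => s / (2 * Real.cosh (2 * s))), cat_int] at h3
  push_cast at h3
  push_cast
  linear_combination -h3 / 2

lemma gg_I (y : ℝ) (hy : 0 < y) : gg (y * I) = I * (y * Real.log y : ℝ) := by
  unfold gg
  have : -(I * (y * I)) = (y : ℂ) := by linear_combination (-(y:ℂ)) * I_sq
  rw [this, ← Complex.ofReal_log hy.le]; push_cast; ring

lemma Jpi : ∫ t : ℝ, gg (t + Real.pi * I) / dd t =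
    I * (Real.pi ^ 2 / 8 * Real.log (27 * Real.pi ^ 2 / 16) - Real.pi * catalan' / 4 : ℝ) := by
  have hp := Real.pi_pos
  have s1 := shift 0 le_rfl
  have s2 := shift (Real.pi / 2) (by positivity)
  rw [J0, zero_add, zero_add, gg_I _ (by positivity)] at s1
  rw [show Real.pi / 2 + Real.pi / 2 = Real.pi by ring,
    show Real.pi / 2 + Real.pi / 4 = 3 * (Real.pi / 4) by ring, gg_I _ (by positivity)] at s2
  have hl : Real.log (27 * Real.pi ^ 2 / 16) =
      3 * Real.log (3 * (Real.pi / 4)) - Real.log (Real.pi / 4) := by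
    rw [show (3:ℝ) = ((3:ℕ):ℝ) by norm_num, ← Real.log_pow, ← Real.log_div (by positivity) (by positivity)]
    congr 1; field_simp; norm_num
  rw [hl]
  push_cast at s1 s2 ⊢
  linear_combination s2 - s1

lemma log_rel (t : ℝ) : Complex.log (t + Real.pi * I) =
    Complex.log (-(I * (t + Real.pi * I))) + Real.pi / 2 * I := by
  have hp := Real.pi_pos
  set w : ℂ := -(I * (t + Real.pi * I)) with hw
  have hre : 0 < w.re := by simp [hw, hp]
  have hw0 : w ≠ 0 := by intro h; rw [h] at hre; simp at hre
  have harg := Complex.abs_arg_lt_pi_div_two_iff.2 (Or.inl hre)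
  rw [abs_lt] at harg
  have e : (t + Real.pi * I : ℂ) = Complex.exp (Complex.log w + Real.pi / 2 * I) := by
    rw [Complex.exp_add, Complex.exp_log hw0, Complex.exp_pi_div_two_mul_I, hw]
    linear_combination ((t + Real.pi * I : ℂ)) * I_sq
  have him : (Complex.log w + Real.pi / 2 * I).im = w.arg + Real.pi / 2 := by
    have : (Real.pi / 2 : ℂ) = ((Real.pi / 2 : ℝ) : ℂ) := by push_cast; rfl
    rw [this]; simp [Complex.log_im]
  conv_lhs => rw [e]
  rw [Complex.log_exp]
  · rw [him]; linarith
  · rw [him]; linarith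

lemma log_neg_exp (t : ℝ) : Complex.log (-((Real.exp t : ℝ) : ℂ)) = t + Real.pi * I := by
  have e : -((Real.exp t : ℝ) : ℂ) = Complex.exp (t + Real.pi * I) := by
    rw [Complex.exp_add, Complex.exp_pi_mul_I]; push_cast; ring
  have hp := Real.pi_pos
  rw [e, Complex.log_exp]
  · simp; linarith
  · simp

lemma subst_exp (f : ℝ → ℂ) : ∫ x in Set.Ioi (0:ℝ), f x = ∫ t : ℝ, Real.exp t • f (Real.exp t) := by
  have h := integral_image_eq_integral_abs_deriv_smul (s := Set.univ) (f := Real.exp)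
    (f' := Real.exp) MeasurableSet.univ (fun x _ => (Real.hasDerivAt_exp x).hasDerivWithinAt)
    Real.exp_injective.injOn f
  rw [Set.image_univ, Real.range_exp] at h
  rw [h, setIntegral_univ]
  simp

lemma int_t : Integrable (fun t : ℝ => (t : ℂ) / dd t) :=
  int_of_bound _ (by fun_prop) 1 (fun t => by
    have := Real.add_one_le_exp |t|
    rw [Complex.norm_real, Real.norm_eq_abs]; linarith)

lemma int_t_zero : ∫ t : ℝ, (t : ℂ) / dd t = 0 := by
  have e : ∫ t : ℝ, (t : ℂ) / dd t = ∫ t : ℝ, -((t : ℂ) / dd t) := by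
    rw [← integral_neg_eq_self]
    congr 1; ext t
    push_cast
    rw [dd_neg, neg_div]
  rw [integral_neg] at e
  linear_combination e / 2

theorem statement18 :
    (∫ x : ℝ in Set.Ioi (0 : ℝ),
        (x : ℂ) * Complex.log (-(x : ℂ)) * Complex.log (Complex.log (-(x : ℂ))) /
          (1 + (x : ℂ) ^ 4)) =
      -((Real.pi : ℂ) / 8) *
        (2 * I * (catalan' : ℂ) +
          (Real.pi : ℂ) * ((Real.pi : ℂ) -
            I * (Real.log (27 * Real.pi ^ 2 / 16) : ℂ))) := by
  rw [subst_exp]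
  have e : ∀ t : ℝ, Real.exp t • (((Real.exp t : ℝ) : ℂ) * Complex.log (-((Real.exp t : ℝ) : ℂ)) *
      Complex.log (Complex.log (-((Real.exp t : ℝ) : ℂ))) / (1 + ((Real.exp t : ℝ) : ℂ) ^ 4)) =
      gg (t + Real.pi * I) / dd t + (Real.pi / 2 * I * (t / dd t) +
        (Real.pi / 2 * I * (Real.pi * I)) / dd t) := by
    intro t
    rw [log_neg_exp, log_rel]
    have hd : dd t = (((1 + Real.exp t ^ 4) / Real.exp t ^ 2 : ℝ) : ℂ) := by
      rw [dd_real, Real.cosh_eq]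
      congr 1
      have h2 : Real.exp (2 * t) = Real.exp t ^ 2 := by rw [← Real.exp_nat_mul]; norm_num
      rw [Real.exp_neg, h2]
      have := Real.exp_pos t
      field_simp
      ring
    have hE : ((Real.exp t : ℝ) : ℂ) ≠ 0 := by exact_mod_cast (Real.exp_pos t).ne'
    have hE4 : (1 + ((Real.exp t : ℝ) : ℂ) ^ 4) ≠ 0 := by
      have : (1 + Real.exp t ^ 4) ≠ 0 := by positivity
      exact_mod_cast this
    rw [hd, Complex.real_smul]
    simp only [gg]
    generalize Complex.log (-(I * (t + Real.pi * I))) = L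
    rw [Complex.ofReal_div, Complex.ofReal_add, Complex.ofReal_one, Complex.ofReal_pow,
      Complex.ofReal_pow]
    generalize ((Real.exp t : ℝ) : ℂ) = E at *
    field_simp
  simp_rw [e]
  have hi : Integrable fun t : ℝ => (Real.pi / 2 * I * (t / dd t) +
        (Real.pi / 2 * I * (Real.pi * I)) / dd t) := (int_t.const_mul _).add (int_const _)
  rw [integral_add (int_J Real.pi Real.pi_pos.le) hi,
    integral_add (int_t.const_mul _) (int_const _), integral_const_mul, int_t_zero, int_w, Jpi]
  push_cast
  linear_combination (Real.pi ^ 3 / 8 : ℂ) * I_sq
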